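/- Let (X,f) be a dynamical system. Then the following are equivalent: (1) (K(X), f̄) is sensitively dependent on initial conditions; (2) (F^1(X), f̃_g) is sensitively dependent on initial conditions for some g ∈ D_m(I) with g⁻¹(1) = {1}; (3) (F^1(X), f̃_g) is sensitively dependent on initial conditions for every g ∈ D_m(I) with g⁻¹(1) = {1}. -/

import Mathlib

noncomputable section

open Set Metric

/-- The unit interval `I = [0,1]` as a subset of `ℝ`. -/
def I01 : Set ℝ := Set.Icc 0 1

/-- `g ∈ D_m(I)`: `g : I → I` is nondecreasing, right-continuous, `g 0 = 0`, `g 1 = 1`. -/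
def Dm (g : ℝ → ℝ) : Prop :=
  MonotoneOn g I01 ∧
  (∀ x ∈ I01, ContinuousWithinAt g (I01 ∩ Set.Ici x) x) ∧
  Set.MapsTo g I01 I01 ∧ g 0 = 0 ∧ g 1 = 1

/-- `ξ_g x = min g⁻¹([x,1])` (the min exists by right-continuity; `sInf` here). -/
def xiG (g : ℝ → ℝ) (x : ℝ) : ℝ := sInf {t | t ∈ I01 ∧ x ≤ g t}

/-- The `α`-cut `[A]_α` of a fuzzy set `A`. -/
def cut {X : Type*} (A : X → ℝ) (α : ℝ) : Set X := {x | α ≤ A x}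

/-- The support of a fuzzy set. -/
def supp {X : Type*} [TopologicalSpace X] (A : X → ℝ) : Set X := closure {x | 0 < A x}

/-- The `g`-cut `[A]_α^g = {x ∈ supp A : g (A x) ≥ α}`. -/
def gcut {X : Type*} [TopologicalSpace X] (g : ℝ → ℝ) (A : X → ℝ) (α : ℝ) : Set X :=
  {x | x ∈ supp A ∧ α ≤ g (A x)}

/-- `A ∈ F(X)`: an upper semicontinuous fuzzy set on `X`. -/
def IsFuzzy {X : Type*} [TopologicalSpace X] (A : X → ℝ) : Prop :=
  UpperSemicontinuous A ∧ ∀ x, A x ∈ I01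

/-- `A ∈ F_0(X)`: a nonempty (not identically 0) upper semicontinuous fuzzy set. -/
def InF0 {X : Type*} [TopologicalSpace X] (A : X → ℝ) : Prop := IsFuzzy A ∧ ∃ x, A x ≠ 0

/-- `A ∈ F^1(X)`: an upper semicontinuous fuzzy set attaining the value 1. -/
def InF1 {X : Type*} [TopologicalSpace X] (A : X → ℝ) : Prop := IsFuzzy A ∧ ∃ x, 1 ≤ A x

/-- The `g`-fuzzification `f̃_g(A)(x) = sup {g (A y) : y ∈ f⁻¹(x)}` (with `sup ∅ = 0`). -/
def fuzz {X : Type*} (f : X → X) (g : ℝ → ℝ) (A : X → ℝ) : X → ℝ :=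
  fun x => sSup ((fun y => g (A y)) '' (f ⁻¹' {x}))

open Classical in
/-- Hausdorff metric, extended by `d_H(∅,∅) = 0` and `d_H(∅,A) = diam X`. -/
def dH {X : Type*} [MetricSpace X] (A B : Set X) : ℝ :=
  if A = ∅ ∧ B = ∅ then 0
  else if A = ∅ ∨ B = ∅ then Metric.diam (Set.univ : Set X)
  else Metric.hausdorffDist A B

/-- The levelwise metric `d_∞(A,B) = sup {d_H([A]_α, [B]_α) : α ∈ (0,1]}`. -/
def dInfty {X : Type*} [MetricSpace X] (A B : X → ℝ) : ℝ :=
  sSup ((fun α => dH (cut A α) (cut B α)) '' Set.Ioc (0:ℝ) 1)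

/-- `K(X)`: the hyperspace of nonempty compact subsets of `X`. -/
def Kc (X : Type*) [MetricSpace X] : Set (Set X) := {A | IsCompact A ∧ A.Nonempty}

section Dyn

variable {Y : Type*}

/-- `U` is a (relatively) open subset of the space `(S, ρ)`. -/
def IsOpenIn (S : Set Y) (ρ : Y → Y → ℝ) (U : Set Y) : Prop :=
  U ⊆ S ∧ ∀ x ∈ U, ∃ ε > 0, ∀ y ∈ S, ρ x y < ε → y ∈ U

/-- Diameter of a set with respect to the distance function `ρ`. -/
def diamIn (ρ : Y → Y → ℝ) (U : Set Y) : ℝ := sSup (Set.image2 ρ U U)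

/-- Sensitive dependence on initial conditions of `T` on the space `(S, ρ)`. -/
def SensitiveOn (S : Set Y) (ρ : Y → Y → ℝ) (T : Y → Y) : Prop :=
  ∃ δ > 0, ∀ x ∈ S, ∀ ε > 0, ∃ y ∈ S, ρ x y < ε ∧ ∃ n : ℕ, δ < ρ (T^[n] x) (T^[n] y)

/-- `𝓕`-sensitivity of `T` on the space `(S, ρ)`. -/
def FSensitiveOn (S : Set Y) (ρ : Y → Y → ℝ) (T : Y → Y) (F : Set (Set ℕ)) : Prop :=
  ∃ ε > 0, ∀ U : Set Y, IsOpenIn S ρ U → U.Nonempty →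
    {n : ℕ | ε < diamIn ρ (T^[n] '' U)} ∈ F

/-- Multi-sensitivity of `T` on the space `(S, ρ)`. -/
def MultiSensitiveOn (S : Set Y) (ρ : Y → Y → ℝ) (T : Y → Y) : Prop :=
  ∃ ε > 0, ∀ (k : ℕ) (U : Fin k → Set Y),
    (∀ i, IsOpenIn S ρ (U i) ∧ (U i).Nonempty) →
    ∃ n : ℕ, ∀ i, ε < diamIn ρ (T^[n] '' U i)

/-- Topological transitivity of `T` on the space `(S, ρ)`. -/
def TransitiveOn (S : Set Y) (ρ : Y → Y → ℝ) (T : Y → Y) : Prop :=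
  ∀ U V : Set Y, IsOpenIn S ρ U → U.Nonempty → IsOpenIn S ρ V → V.Nonempty →
    ∃ n : ℕ, ((T^[n] '' U) ∩ V).Nonempty

/-- Weak mixing: `T × T` is transitive on `(S × S, max-metric)`. -/
def WeaklyMixingOn (S : Set Y) (ρ : Y → Y → ℝ) (T : Y → Y) : Prop :=
  TransitiveOn (S ×ˢ S) (fun p q => max (ρ p.1 q.1) (ρ p.2 q.2)) (Prod.map T T)

end Dyn

/-- A (proper) Furstenberg family on `ℤ⁺ = ℕ`. -/
def FurstenbergFamily (F : Set (Set ℕ)) : Prop :=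
  (∀ F1 F2 : Set ℕ, F1 ∈ F → F1 ⊆ F2 → F2 ∈ F) ∧ Set.univ ∈ F ∧ ∅ ∉ F

theorem dH_of_nonempty {X : Type*} [MetricSpace X] {A B : Set X} (hA : A.Nonempty)
    (hB : B.Nonempty) : dH A B = hausdorffDist A B := by
  simp [dH, hA.ne_empty, hB.ne_empty]

theorem hausdorffEDist_ne_top_of_nonempty {X : Type*} [MetricSpace X] [CompactSpace X]
    {A B : Set X} (hA : A.Nonempty) (hB : B.Nonempty) : hausdorffEDist A B ≠ ⊤ :=
  hausdorffEDist_ne_top_of_nonempty_of_bounded hA hB isBounded_of_compactSpace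
    isBounded_of_compactSpace

theorem dH_le_diam {X : Type*} [MetricSpace X] [CompactSpace X] (A B : Set X) :
    dH A B ≤ diam (univ : Set X) := by
  unfold dH
  split_ifs with h1 h2
  · exact diam_nonneg
  · exact le_rfl
  · push Not at h2
    exact (hausdorffDist_le_diam h2.1 isBounded_of_compactSpace h2.2
      isBounded_of_compactSpace).trans (diam_mono (subset_univ _) isBounded_of_compactSpace)

theorem dH_cut_le_dInfty {X : Type*} [MetricSpace X] [CompactSpace X] (A B : X → ℝ) {α : ℝ}
    (hα : α ∈ Ioc (0 : ℝ) 1) : dH (cut A α) (cut B α) ≤ dInfty A B := by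
  refine le_csSup ⟨diam (univ : Set X), ?_⟩ ⟨α, hα, rfl⟩
  rintro _ ⟨β, -, rfl⟩
  exact dH_le_diam _ _

theorem exists_lt_dH_cut {X : Type*} [MetricSpace X] {A B : X → ℝ} {δ : ℝ}
    (h : δ < dInfty A B) : ∃ α ∈ Ioc (0 : ℝ) 1, δ < dH (cut A α) (cut B α) := by
  obtain ⟨_, ⟨α, hα, rfl⟩, h⟩ := exists_lt_of_lt_csSup
    ((nonempty_Ioc.2 one_pos).image _) h
  exact ⟨α, hα, h⟩

theorem dInfty_le {X : Type*} [MetricSpace X] {A B : X → ℝ} {r : ℝ}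
    (h : ∀ α ∈ Ioc (0 : ℝ) 1, dH (cut A α) (cut B α) ≤ r) : dInfty A B ≤ r := by
  refine csSup_le ((nonempty_Ioc.2 one_pos).image _) ?_
  rintro _ ⟨α, hα, rfl⟩
  exact h α hα

theorem isClosed_cut {X : Type*} [TopologicalSpace X] {A : X → ℝ} (hA : InF1 A) (α : ℝ) :
    IsClosed (cut A α) :=
  hA.1.1.isClosed_preimage α

theorem cut_nonempty {X : Type*} [TopologicalSpace X] {A : X → ℝ} (hA : InF1 A) {α : ℝ}
    (hα : α ≤ 1) : (cut A α).Nonempty :=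
  hA.2.imp fun _ hx => hα.trans hx

/-- For `g ∈ D_m(I)`, the superlevel sets of `g` are closed upper intervals of `I`. -/
theorem Dm.exists_le_iff {g : ℝ → ℝ} (hg : Dm g) {α : ℝ} (hα : α ∈ Ioc (0 : ℝ) 1) :
    ∃ β ∈ Ioc (0 : ℝ) 1, ∀ t ∈ I01, α ≤ g t ↔ β ≤ t := by
  obtain ⟨hmono, hcont, -, h0, h1⟩ := hg
  let S : Set ℝ := {t | t ∈ I01 ∧ α ≤ g t}
  have h1S : (1 : ℝ) ∈ S := ⟨⟨zero_le_one, le_rfl⟩, h1.symm ▸ hα.2⟩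
  have hbdd : BddBelow S := ⟨0, fun t ht => ht.1.1⟩
  have hβI : sInf S ∈ I01 := ⟨le_csInf ⟨1, h1S⟩ fun t ht => ht.1.1, csInf_le hbdd h1S⟩
  have hβ : α ≤ g (sInf S) := by
    by_contra! hlt
    have hev := (hcont _ hβI).eventually (gt_mem_nhds hlt)
    obtain ⟨u, hu, -, hmem⟩ := exists_seq_tendsto_sInf ⟨1, h1S⟩ hbdd |>.imp fun u hu =>
      (⟨hu.2.1, hu.1, hu.2.2⟩ : _ ∧ _ ∧ _)
    have : Filter.Tendsto u Filter.atTop (nhdsWithin (sInf S) (I01 ∩ Ici (sInf S))) :=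
      tendsto_nhdsWithin_iff.2
        ⟨hu, Filter.Eventually.of_forall fun n => ⟨(hmem n).1, csInf_le hbdd (hmem n)⟩⟩
    obtain ⟨n, hn⟩ := (this.eventually hev).exists
    exact hn.not_ge (hmem n).2
  refine ⟨sInf S, ⟨hβI.1.lt_of_ne fun h => ?_, hβI.2⟩, fun t ht => ⟨fun h => ?_, fun h => ?_⟩⟩
  · rw [← h, h0] at hβ
    exact hβ.not_gt hα.1
  · exact csInf_le hbdd ⟨ht, h⟩
  · exact hβ.trans (hmono hβI ht h)

/-- The supremum defining `fuzz f g A` is attained on nonempty fibres. -/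
theorem exists_isGreatest_fuzz {X : Type*} [MetricSpace X] [CompactSpace X] {f : X → X}
    (hf : Continuous f) {g : ℝ → ℝ} (hg : Dm g) {A : X → ℝ} (hA : IsFuzzy A) {x : X}
    (hx : (f ⁻¹' {x}).Nonempty) :
    ∃ y, f y = x ∧ fuzz f g A x = g (A y) ∧ ∀ z, f z = x → g (A z) ≤ g (A y) := by
  obtain ⟨y, hy, hmax⟩ := (hA.1.upperSemicontinuousOn _).exists_isMaxOn hx
    (isClosed_singleton.preimage hf).isCompact
  have hle : ∀ z, f z = x → g (A z) ≤ g (A y) := fun z hz =>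
    hg.1 (hA.2 z) (hA.2 y) (hmax hz)
  refine ⟨y, hy, IsGreatest.csSup_eq ⟨⟨y, hy, rfl⟩, ?_⟩, hle⟩
  rintro _ ⟨z, hz, rfl⟩
  exact hle z hz

theorem fuzz_mem_I01 {X : Type*} [MetricSpace X] [CompactSpace X] {f : X → X}
    (hf : Continuous f) {g : ℝ → ℝ} (hg : Dm g) {A : X → ℝ} (hA : IsFuzzy A) (x : X) :
    fuzz f g A x ∈ I01 := by
  rcases (f ⁻¹' {x}).eq_empty_or_nonempty with he | hne
  · simp [fuzz, he, I01]
  · obtain ⟨y, -, h, -⟩ := exists_isGreatest_fuzz hf hg hA hne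
    exact h ▸ hg.2.2.1 (hA.2 y)

theorem le_fuzz_iff {X : Type*} [MetricSpace X] [CompactSpace X] {f : X → X}
    (hf : Continuous f) {g : ℝ → ℝ} (hg : Dm g) {A : X → ℝ} (hA : IsFuzzy A) {α : ℝ}
    (hα : 0 < α) (x : X) : α ≤ fuzz f g A x ↔ ∃ y, f y = x ∧ α ≤ g (A y) := by
  rcases (f ⁻¹' {x}).eq_empty_or_nonempty with he | hne
  · have : ∀ y, f y ≠ x := fun y hy => he.subset (show y ∈ f ⁻¹' {x} from hy)
    simp [fuzz, he, this, hα]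
  · obtain ⟨y, hy, h, hle⟩ := exists_isGreatest_fuzz hf hg hA hne
    rw [h]
    exact ⟨fun h' => ⟨y, hy, h'⟩, fun ⟨z, hz, h'⟩ => h'.trans (hle z hz)⟩

theorem cut_fuzz {X : Type*} [MetricSpace X] [CompactSpace X] {f : X → X}
    (hf : Continuous f) {g : ℝ → ℝ} (hg : Dm g) {A : X → ℝ} (hA : IsFuzzy A) {α β : ℝ}
    (hα : 0 < α) (h : ∀ t ∈ I01, α ≤ g t ↔ β ≤ t) : cut (fuzz f g A) α = f '' cut A β := by
  ext x
  simp only [cut, mem_ofPred_eq, le_fuzz_iff hf hg hA hα, mem_image]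
  exact exists_congr fun y => by rw [h _ (hA.2 y), and_comm]

theorem InF1.fuzz {X : Type*} [MetricSpace X] [CompactSpace X] {f : X → X}
    (hf : Continuous f) {g : ℝ → ℝ} (hg : Dm g) {A : X → ℝ} (hA : InF1 A) :
    InF1 (fuzz f g A) := by
  have hI := fuzz_mem_I01 hf hg hA.1
  refine ⟨⟨upperSemicontinuous_iff_isClosed_preimage.2 fun α => ?_, hI⟩, ?_⟩
  · rcases le_or_gt α 0 with h0 | h0
    · convert isClosed_univ
      exact eq_univ_of_forall fun x => h0.trans (hI x).1
    rcases le_or_gt α 1 with h1 | h1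
    · obtain ⟨β, -, hβ⟩ := hg.exists_le_iff ⟨h0, h1⟩
      change IsClosed (cut (_root_.fuzz f g A) α)
      rw [cut_fuzz hf hg hA.1 h0 hβ]
      exact ((isClosed_cut hA β).isCompact.image hf).isClosed
    · convert isClosed_empty
      exact eq_empty_of_forall_notMem fun x hx => (hI x).2.not_gt (h1.trans_le hx)
  · obtain ⟨x, hx⟩ := hA.2
    refine ⟨f x, (le_fuzz_iff hf hg hA.1 one_pos _).2 ⟨x, rfl, ?_⟩⟩
    rw [le_antisymm (hA.1.2 x).2 hx, hg.2.2.2.2]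

theorem InF1.iterate_fuzz {X : Type*} [MetricSpace X] [CompactSpace X] {f : X → X}
    (hf : Continuous f) {g : ℝ → ℝ} (hg : Dm g) {A : X → ℝ} (hA : InF1 A) (n : ℕ) :
    InF1 ((_root_.fuzz f g)^[n] A) := by
  induction n with
  | zero => exact hA
  | succ n ih =>
    rw [Function.iterate_succ_apply']
    exact ih.fuzz hf hg

theorem exists_cut_iterate_fuzz {X : Type*} [MetricSpace X] [CompactSpace X] {f : X → X}
    (hf : Continuous f) {g : ℝ → ℝ} (hg : Dm g) (n : ℕ) {α : ℝ} (hα : α ∈ Ioc (0 : ℝ) 1) :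
    ∃ β ∈ Ioc (0 : ℝ) 1, ∀ A : X → ℝ, InF1 A →
      cut ((fuzz f g)^[n] A) α = (Set.image f)^[n] (cut A β) := by
  induction n generalizing α with
  | zero => exact ⟨α, hα, fun A _ => rfl⟩
  | succ n ih =>
    obtain ⟨γ, hγ, hγ'⟩ := hg.exists_le_iff hα
    obtain ⟨β, hβ, hβ'⟩ := ih hγ
    refine ⟨β, hβ, fun A hA => ?_⟩
    rw [Function.iterate_succ_apply', Function.iterate_succ_apply',
      cut_fuzz hf hg (hA.iterate_fuzz hf hg n).1 hα.1 hγ', hβ' A hA]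

theorem cut_one_iterate_fuzz {X : Type*} [MetricSpace X] [CompactSpace X] {f : X → X}
    (hf : Continuous f) {g : ℝ → ℝ} (hg : Dm g) (hg1 : ∀ t ∈ I01, (g t = 1 ↔ t = 1)) (n : ℕ)
    {A : X → ℝ} (hA : InF1 A) :
    cut ((fuzz f g)^[n] A) 1 = (Set.image f)^[n] (cut A 1) := by
  induction n with
  | zero => rfl
  | succ n ih =>
    rw [Function.iterate_succ_apply', Function.iterate_succ_apply',
      cut_fuzz hf hg (hA.iterate_fuzz hf hg n).1 one_pos, ih]
    intro t ht
    rw [(hg.2.2.1 ht).2.ge_iff_eq, ht.2.ge_iff_eq, hg1 t ht]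

/-- The fuzzy set equal to `1` on `L` and to `min A c` elsewhere. -/
def capWith {X : Type*} (L : Set X) (c : ℝ) (A : X → ℝ) : X → ℝ :=
  fun x => max (L.indicator (fun _ => 1) x) (min (A x) c)

theorem le_capWith_iff {X : Type*} {L : Set X} {c : ℝ} {A : X → ℝ} {α : ℝ}
    (hα : α ∈ Ioc (0 : ℝ) 1) (x : X) :
    α ≤ capWith L c A x ↔ x ∈ L ∨ (α ≤ A x ∧ α ≤ c) := by
  by_cases hx : x ∈ L <;> simp [capWith, hx, hα.2, hα.1]

theorem cut_capWith_of_le {X : Type*} {L : Set X} {c : ℝ} {A : X → ℝ} {α : ℝ}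
    (hα : α ∈ Ioc (0 : ℝ) 1) (hc : α ≤ c) : cut (capWith L c A) α = cut A α ∪ L := by
  ext x
  simp [cut, le_capWith_iff hα, hc, or_comm]

theorem cut_capWith_of_lt {X : Type*} {L : Set X} {c : ℝ} {A : X → ℝ} {α : ℝ}
    (hα : α ∈ Ioc (0 : ℝ) 1) (hc : c < α) : cut (capWith L c A) α = L := by
  ext x
  simp [cut, le_capWith_iff hα, hc]

theorem inF1_capWith {X : Type*} [TopologicalSpace X] {L : Set X} (hL : IsClosed L)
    (hne : L.Nonempty) {c : ℝ} (hc : c ∈ I01) {A : X → ℝ} (hA : IsFuzzy A) :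
    InF1 (capWith L c A) := by
  refine ⟨⟨?_, fun x => ?_⟩, hne.imp fun x hx => ?_⟩
  · exact (hL.upperSemicontinuous_indicator zero_le_one).sup
      (hA.1.inf upperSemicontinuous_const)
  · exact ⟨le_max_of_le_right (le_min (hA.2 x).1 hc.1),
      max_le (indicator_le_self' (fun _ _ => zero_le_one) x) (min_le_of_right_le hc.2)⟩
  · simp [capWith, hx]

/-- The cuts of `A` at levels close to `1` are close to the cut at level `1`. -/
theorem exists_cut_subset_thickening {X : Type*} [MetricSpace X] [CompactSpace X] {A : X → ℝ}
    (hA : IsFuzzy A) {r : ℝ} (hr : 0 < r) :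
    ∃ c ∈ Ioo (0 : ℝ) 1, cut A c ⊆ thickening r (cut A 1) := by
  rcases (thickening r (cut A 1))ᶜ.eq_empty_or_nonempty with he | hne
  · exact ⟨1 / 2, by norm_num, by simp [compl_empty_iff.1 he]⟩
  · obtain ⟨x, hx, hmax⟩ := (hA.1.upperSemicontinuousOn _).exists_isMaxOn hne
      isOpen_thickening.isClosed_compl.isCompact
    have hx1 : A x < 1 := by
      by_contra! h
      exact hx (self_subset_thickening hr _ h)
    have hx0 := (hA.2 x).1
    refine ⟨(A x + 1) / 2, ⟨by linarith, by linarith⟩, fun y hy => ?_⟩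
    by_contra hy'
    have h1 : A y ≤ A x := hmax hy'
    have h2 : (A x + 1) / 2 ≤ A y := hy
    linarith

theorem sensitiveOn_Kc_of_fuzz {X : Type*} [MetricSpace X] [CompactSpace X] {f : X → X}
    (hf : Continuous f) {g : ℝ → ℝ} (hg : Dm g)
    (h : SensitiveOn {A : X → ℝ | InF1 A} dInfty (fuzz f g)) :
    SensitiveOn (Kc X) dH (Set.image f) := by
  obtain ⟨δ, hδ, h⟩ := h
  refine ⟨δ, hδ, fun K hK ε hε => ?_⟩
  have hA : InF1 (capWith K 0 (0 : X → ℝ)) := inF1_capWith hK.1.isClosed hK.2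
    ⟨le_rfl, zero_le_one⟩ ⟨upperSemicontinuous_const, fun _ => ⟨le_rfl, zero_le_one⟩⟩
  obtain ⟨B, hB, hAB, n, hn⟩ := h _ hA ε hε
  obtain ⟨α, hα, hn⟩ := exists_lt_dH_cut hn
  obtain ⟨β, hβ, hcut⟩ := exists_cut_iterate_fuzz hf hg n hα
  rw [hcut _ hA, hcut _ hB, cut_capWith_of_lt hβ hβ.1] at hn
  refine ⟨cut B β, ⟨(isClosed_cut hB β).isCompact, cut_nonempty hB hβ.2⟩, ?_, n, hn⟩
  refine lt_of_le_of_lt ?_ hAB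
  simpa only [cut_capWith_of_lt hβ hβ.1] using
    dH_cut_le_dInfty (capWith K 0 (0 : X → ℝ)) B hβ

theorem sensitiveOn_fuzz_of_Kc {X : Type*} [MetricSpace X] [CompactSpace X] {f : X → X}
    (hf : Continuous f) {g : ℝ → ℝ} (hg : Dm g) (hg1 : ∀ t ∈ I01, (g t = 1 ↔ t = 1))
    (h : SensitiveOn (Kc X) dH (Set.image f)) :
    SensitiveOn {A : X → ℝ | InF1 A} dInfty (fuzz f g) := by
  obtain ⟨δ, hδ, h⟩ := h
  refine ⟨δ, hδ, fun A (hA : InF1 A) ε hε => ?_⟩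
  have hK := cut_nonempty hA le_rfl
  obtain ⟨L, ⟨hLc, hL⟩, hKL, n, hn⟩ := h (cut A 1) ⟨(isClosed_cut hA 1).isCompact, hK⟩
    (ε / 4) (by linarith)
  obtain ⟨c, hc, hcA⟩ := exists_cut_subset_thickening hA.1 (show 0 < ε / 4 by linarith)
  have hB : InF1 (capWith L c A) := inF1_capWith hLc.isClosed hL ⟨hc.1.le, hc.2.le⟩ hA.1
  rw [dH_of_nonempty hK hL] at hKL
  have hfin := hausdorffEDist_ne_top_of_nonempty hK hL
  have hLK : ∀ y ∈ L, ∀ α ≤ (1 : ℝ), ∃ x ∈ cut A α, dist y x ≤ ε / 2 := fun y hy α hα => by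
    obtain ⟨x, hx, hxy⟩ := exists_dist_lt_of_hausdorffDist_lt' hy hKL hfin
    exact ⟨x, hα.trans hx, by rw [dist_comm]; linarith⟩
  refine ⟨capWith L c A, hB, ?_, n, ?_⟩
  · refine (dInfty_le (r := ε / 2) fun α hα => ?_).trans_lt (by linarith)
    rw [dH_of_nonempty (cut_nonempty hA hα.2) (cut_nonempty hB hα.2)]
    rcases le_or_gt α c with hαc | hαc
    · rw [cut_capWith_of_le hα hαc]
      refine hausdorffDist_le_of_mem_dist (by linarith)
        (fun x hx => ⟨x, .inl hx, by rw [dist_self]; linarith⟩) fun y hy => ?_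
      rcases hy with hy | hy
      · exact ⟨y, hy, by rw [dist_self]; linarith⟩
      · exact hLK y hy α hα.2
    · rw [cut_capWith_of_lt hα hαc]
      refine hausdorffDist_le_of_mem_dist (by linarith) (fun x hx => ?_)
        fun y hy => hLK y hy α hα.2
      obtain ⟨k, hk, hxk⟩ := mem_thickening_iff.1 (hcA (hαc.le.trans hx))
      obtain ⟨l, hl, hkl⟩ := exists_dist_lt_of_hausdorffDist_lt hk hKL hfin
      exact ⟨l, hl, by linarith [dist_triangle x k l]⟩
  · refine hn.trans_le ?_
    have h1 : (1 : ℝ) ∈ Ioc (0 : ℝ) 1 := ⟨one_pos, le_rfl⟩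
    have := dH_cut_le_dInfty ((fuzz f g)^[n] A) ((fuzz f g)^[n] (capWith L c A)) h1
    rwa [cut_one_iterate_fuzz hf hg hg1 n hA, cut_one_iterate_fuzz hf hg hg1 n hB,
      cut_capWith_of_lt h1 hc.2] at this

theorem Dm_id : Dm id :=
  ⟨monotoneOn_id, fun _ _ => continuousWithinAt_id, mapsTo_id _, rfl, rfl⟩

/-- The following are equivalent: (1) `(K(X), f̄)` is sensitively
dependent; (2) `(F^1(X), f̃_g)` is sensitively dependent for some `g ∈ D_m(I)`
with `g⁻¹(1) = {1}`; (3) the same for every such `g`. -/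
theorem stmt9 {X : Type*} [MetricSpace X] [CompactSpace X]
    (f : X → X) (hf : Continuous f) :
    List.TFAE
      [SensitiveOn (Kc X) dH (Set.image f),
       ∃ g : ℝ → ℝ, Dm g ∧ (∀ t ∈ I01, (g t = 1 ↔ t = 1)) ∧
         SensitiveOn {A : X → ℝ | InF1 A} dInfty (fuzz f g),
       ∀ g : ℝ → ℝ, Dm g → (∀ t ∈ I01, (g t = 1 ↔ t = 1)) →
         SensitiveOn {A : X → ℝ | InF1 A} dInfty (fuzz f g)] := by
  tfae_have 1 → 3 := fun h g hg hg1 => sensitiveOn_fuzz_of_Kc hf hg hg1 h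
  tfae_have 3 → 2 := fun h => ⟨id, Dm_id, fun _ _ => Iff.rfl, h id Dm_id fun _ _ => Iff.rfl⟩
  tfae_have 2 → 1 := fun ⟨_, hg, _, h⟩ => sensitiveOn_Kc_of_fuzz hf hg h
  tfae_finish
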